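/- For τ ∈ [0, 2), define f_τ: [0, ∞) → ℝ by f_τ(u) = log(1 + u) if τ = 1 and f_τ(u) = ((1 + u)^{1−τ} − 1)/(1 − τ) if τ ≠ 1. Then: (i) for every τ ∈ [0, 2), f_τ is non-decreasing and concave on [0, ∞); and (ii) for all real numbers u₁ ≥ u₂ ≥ 0 and all 0 ≤ τ ≤ τ′ < 2, f_{τ′}(u₁) − f_{τ′}(u₂) ≤ f_τ(u₁) − f_τ(u₂); that is, for fixed u₁ ≥ u₂ ≥ 0 the map τ ↦ f_τ(u₁) − f_τ(u₂) is non-increasing on [0, 2). -/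

import Mathlib

/-- `f_τ(u) = log(1+u)` if `τ = 1`, and `((1+u)^{1-τ} - 1)/(1-τ)` otherwise. -/
noncomputable def fcomp (τ u : ℝ) : ℝ :=
  if τ = 1 then Real.log (1 + u) else ((1 + u) ^ (1 - τ) - 1) / (1 - τ)

theorem hasDerivAt_fcomp (τ : ℝ) {u : ℝ} (hu : 0 ≤ u) :
    HasDerivAt (fcomp τ) ((1 + u) ^ (-τ)) u := by
  have hpos : 0 < 1 + u := by linarith
  have hadd : HasDerivAt (fun x : ℝ => 1 + x) 1 u := (hasDerivAt_id u).const_add 1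
  by_cases hτ : τ = 1
  · subst hτ
    have hlog := hadd.log hpos.ne'
    have heq : fcomp 1 = fun x => Real.log (1 + x) := by
      funext x
      simp [fcomp]
    rw [heq, Real.rpow_neg_one, ← one_div]
    exact hlog
  · have hne : 1 - τ ≠ 0 := sub_ne_zero.mpr (Ne.symm hτ)
    have hpow := ((hadd.rpow_const (p := 1 - τ) (Or.inl hpos.ne')).sub_const 1).div_const (1 - τ)
    have heq : fcomp τ = fun x => ((1 + x) ^ (1 - τ) - 1) / (1 - τ) := by
      funext x
      simp [fcomp, hτ]
    rw [heq]
    refine hpow.congr_deriv ?_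
    rw [show 1 - τ - 1 = -τ by ring]
    field_simp

theorem continuousOn_fcomp (τ : ℝ) : ContinuousOn (fcomp τ) (Set.Ici 0) :=
  fun _ hu => (hasDerivAt_fcomp τ hu).continuousAt.continuousWithinAt

theorem monotoneOn_fcomp (τ : ℝ) : MonotoneOn (fcomp τ) (Set.Ici 0) := by
  refine monotoneOn_of_hasDerivWithinAt_nonneg (convex_Ici 0) (continuousOn_fcomp τ)
    (fun u hu => (hasDerivAt_fcomp τ (interior_subset hu)).hasDerivWithinAt) fun u hu => ?_
  have hu' : 0 ≤ u := interior_subset hu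
  positivity

theorem concaveOn_fcomp {τ : ℝ} (hτ : 0 ≤ τ) : ConcaveOn ℝ (Set.Ici 0) (fcomp τ) := by
  refine AntitoneOn.concaveOn_of_deriv (convex_Ici 0) (continuousOn_fcomp τ)
    (fun u hu => (hasDerivAt_fcomp τ (interior_subset hu)).differentiableAt.differentiableWithinAt)
    fun u hu v hv huv => ?_
  have hu' : 0 ≤ u := interior_subset hu
  rw [(hasDerivAt_fcomp τ hu').deriv, (hasDerivAt_fcomp τ (hu'.trans huv)).deriv]
  exact Real.rpow_le_rpow_of_nonpos (by linarith) (by linarith) (by linarith)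

theorem monotoneOn_fcomp_sub_fcomp {τ τ' : ℝ} (h : τ ≤ τ') :
    MonotoneOn (fun u => fcomp τ u - fcomp τ' u) (Set.Ici 0) := by
  refine monotoneOn_of_hasDerivWithinAt_nonneg (convex_Ici 0)
    ((continuousOn_fcomp τ).sub (continuousOn_fcomp τ'))
    (fun u hu => ((hasDerivAt_fcomp τ (interior_subset hu)).sub
      (hasDerivAt_fcomp τ' (interior_subset hu))).hasDerivWithinAt) fun u hu => ?_
  have hu' : 0 ≤ u := interior_subset hu
  exact sub_nonneg.mpr (Real.rpow_le_rpow_of_exponent_le (by linarith) (by linarith))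

theorem stmt12 :
    (∀ τ ∈ Set.Ico (0 : ℝ) 2,
      MonotoneOn (fcomp τ) (Set.Ici 0) ∧ ConcaveOn ℝ (Set.Ici 0) (fcomp τ)) ∧
    (∀ u₁ u₂ : ℝ, 0 ≤ u₂ → u₂ ≤ u₁ → ∀ τ τ' : ℝ, 0 ≤ τ → τ ≤ τ' → τ' < 2 →
      fcomp τ' u₁ - fcomp τ' u₂ ≤ fcomp τ u₁ - fcomp τ u₂) := by
  refine ⟨fun τ hτ => ⟨monotoneOn_fcomp τ, concaveOn_fcomp hτ.1⟩, ?_⟩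
  intro u₁ u₂ hu₂ hu τ τ' _ hττ' _
  have h := monotoneOn_fcomp_sub_fcomp hττ' (Set.mem_Ici.mpr hu₂)
    (Set.mem_Ici.mpr (hu₂.trans hu)) hu
  dsimp only at h
  linarith
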